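/- Let m : M¹ → M² and n : N¹ → N² be chain maps between cochain complexes of k-modules, and let μ = (μ¹, μ⁰, μ²) be a degree-0 triple morphism from (M¹, m, M²) to (N¹, n, N²) with Dμ = 0. If μ¹ and μ² are homotopy equivalences of complexes with chosen homotopy inverses ν¹ : N¹ → M¹ and ν² : N² → M², then there exists a degree −1 morphism ν⁰ : N¹ → M² such that the triple ν = (ν¹, ν⁰, ν²) from (N¹, n, N²) to (M¹, m, M²) satisfies Dν = 0; equivalently, there exists ν⁰ with dν⁰ = ν² ∘ n − m ∘ ν¹. -/

import Mathlib

namespace ThesisDG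

universe u

/-- A `ℤ`-indexed family of `k`-modules together with maps `d i j` (morally supported
on `j = i + 1`).  The axioms of a cochain complex are recorded separately in
`Cx.IsComplex`. -/
structure Cx (k : Type u) [CommRing k] where
  X : ℤ → Type u
  [grp : ∀ i, AddCommGroup (X i)]
  [mod : ∀ i, Module k (X i)]
  d : ∀ i j : ℤ, X i →ₗ[k] X j

attribute [instance] Cx.grp Cx.mod

variable {k : Type u} [CommRing k]

/-- `A` is a genuine cochain complex: the differential is supported in degree `+1`
and squares to zero. -/
def Cx.IsComplex (A : Cx k) : Prop :=
  (∀ i j : ℤ, i + 1 ≠ j → A.d i j = 0) ∧ ∀ i j l : ℤ, (A.d j l).comp (A.d i j) = 0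

/-- Graded morphisms between two graded objects: doubly indexed families of `k`-linear
maps `A.X i →ₗ[k] B.X j`.  A degree-`n` morphism is such a family supported on
`j = i + n`, see `Mor.HasDeg`. -/
abbrev Mor (A B : Cx k) := ∀ i j : ℤ, A.X i →ₗ[k] B.X j

/-- `f` is homogeneous of degree `n`, i.e. supported on `j = i + n`. -/
def Mor.HasDeg {A B : Cx k} (f : Mor A B) (n : ℤ) : Prop :=
  ∀ i j : ℤ, i + n ≠ j → f i j = 0

/-- The differential `df = d_B ∘ f - (-1)ⁿ f ∘ d_A` of a degree-`n` morphism `f`. -/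
def Mor.diff {A B : Cx k} (n : ℤ) (f : Mor A B) : Mor A B := fun i j =>
  (B.d (i + n) j).comp (f i (i + n)) -
    (n.negOnePow : ℤ) • ((f (i + 1) j).comp (A.d i (i + 1)))

/-- Composition `g ∘ f` (the morphism `f`, of degree `m`, is applied first). -/
def Mor.comp {A B C : Cx k} (g : Mor B C) (f : Mor A B) (m : ℤ) : Mor A C := fun i j =>
  (g (i + m) j).comp (f i (i + m))

/-- Transport along an equality of degrees. -/
def Cx.cast (A : Cx k) : ∀ {i j : ℤ}, i = j → (A.X i →ₗ[k] A.X j)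
  | _, _, rfl => LinearMap.id

/-- The identity (degree-`0`) morphism. -/
def idM (A : Cx k) : Mor A A := fun i j => if h : i = j then A.cast h else 0

/-- `f` is closed as a degree-`n` morphism: `df = 0`. -/
def IsClosed {A B : Cx k} (n : ℤ) (f : Mor A B) : Prop := Mor.diff n f = 0

/-- A chain map is a closed morphism of degree `0`. -/
def IsChainMap {A B : Cx k} (f : Mor A B) : Prop := Mor.HasDeg f 0 ∧ IsClosed 0 f

/-- Two degree-`n` morphisms are homotopic if their difference is the differential of a
morphism of degree `n - 1`. -/
def Homotopic {A B : Cx k} (n : ℤ) (f g : Mor A B) : Prop :=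
  ∃ s : Mor A B, Mor.HasDeg s (n - 1) ∧ Mor.diff (n - 1) s = f - g

/-- `g` is a homotopy inverse of the chain map `f`: both are chain maps and both
composites are homotopic to the identity. -/
def AreHtpyInverse {A B : Cx k} (f : Mor A B) (g : Mor B A) : Prop :=
  IsChainMap f ∧ IsChainMap g ∧
    Homotopic 0 (Mor.comp g f 0) (idM A) ∧ Homotopic 0 (Mor.comp f g 0) (idM B)

/-- A chain map is a homotopy equivalence if it admits a homotopy inverse. -/
def IsHtpyEquiv {A B : Cx k} (f : Mor A B) : Prop := ∃ g : Mor B A, AreHtpyInverse f g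

variable {M₁ M₂ N₁ N₂ P₁ P₂ : Cx k}

/-- A triple morphism `(μ¹, μ⁰, μ²)` from `(M₁, m, M₂)` to `(N₁, n, N₂)`. -/
structure Triple (M₁ M₂ N₁ N₂ : Cx k) where
  one : Mor M₁ N₁
  zero : Mor M₁ N₂
  two : Mor M₂ N₂

/-- A triple morphism has degree `κ` if `μ¹, μ²` have degree `κ` and `μ⁰` has degree
`κ - 1`. -/
def Triple.HasDeg (μ : Triple M₁ M₂ N₁ N₂) (κ : ℤ) : Prop :=
  Mor.HasDeg μ.one κ ∧ Mor.HasDeg μ.zero (κ - 1) ∧ Mor.HasDeg μ.two κ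

/-- The differential `Dμ = (dμ¹, dμ⁰ + (-1)^κ (n ∘ μ¹ - μ² ∘ m), dμ²)` of a degree-`κ`
triple morphism over the chain maps `m`, `n`. -/
def Triple.diffT (m : Mor M₁ M₂) (n : Mor N₁ N₂) (κ : ℤ) (μ : Triple M₁ M₂ N₁ N₂) :
    Triple M₁ M₂ N₁ N₂ where
  one := Mor.diff κ μ.one
  zero := Mor.diff (κ - 1) μ.zero +
    (κ.negOnePow : ℤ) • (Mor.comp n μ.one κ - Mor.comp μ.two m 0)
  two := Mor.diff κ μ.two

/-- `μ` is closed: `Dμ = 0`. -/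
def Triple.IsClosedT (m : Mor M₁ M₂) (n : Mor N₁ N₂) (κ : ℤ)
    (μ : Triple M₁ M₂ N₁ N₂) : Prop :=
  (Triple.diffT m n κ μ).one = 0 ∧ (Triple.diffT m n κ μ).zero = 0 ∧
    (Triple.diffT m n κ μ).two = 0

/-- Two degree-`κ` triple morphisms are homotopic if their difference is `Dξ` for a
degree-`κ - 1` triple morphism `ξ`. -/
def Triple.HomotopicT (m : Mor M₁ M₂) (n : Mor N₁ N₂) (κ : ℤ)
    (μ ν : Triple M₁ M₂ N₁ N₂) : Prop :=
  ∃ ξ : Triple M₁ M₂ N₁ N₂, ξ.HasDeg (κ - 1) ∧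
    (Triple.diffT m n (κ - 1) ξ).one = μ.one - ν.one ∧
    (Triple.diffT m n (κ - 1) ξ).zero = μ.zero - ν.zero ∧
    (Triple.diffT m n (κ - 1) ξ).two = μ.two - ν.two

/-- Composition of triple morphisms (the morphism `μ`, of degree `κ`, is applied first):
`ν ∘ μ = (ν¹ ∘ μ¹, ν² ∘ μ⁰ + (-1)^κ ν⁰ ∘ μ¹, ν² ∘ μ²)`. -/
def Triple.compT (ν : Triple N₁ N₂ P₁ P₂) (μ : Triple M₁ M₂ N₁ N₂) (κ : ℤ) :
    Triple M₁ M₂ P₁ P₂ where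
  one := Mor.comp ν.one μ.one κ
  zero := Mor.comp ν.two μ.zero (κ - 1) + (κ.negOnePow : ℤ) • Mor.comp ν.zero μ.one κ
  two := Mor.comp ν.two μ.two κ

/-- The identity triple morphism `(id, 0, id)`. -/
def Triple.idT (M₁ M₂ : Cx k) : Triple M₁ M₂ M₁ M₂ := ⟨idM M₁, 0, idM M₂⟩

/-- A closed degree-`0` triple morphism `μ` over `(m, n)` is a homotopy equivalence in
the triple category if there is a closed degree-`0` triple `ν` in the opposite
direction with `ν ∘ μ - id` and `μ ∘ ν - id` both of the form `Dξ` for degree-`-1`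
triples `ξ`. -/
def Triple.IsHtpyEquivT (m : Mor M₁ M₂) (n : Mor N₁ N₂) (μ : Triple M₁ M₂ N₁ N₂) : Prop :=
  μ.HasDeg 0 ∧ Triple.IsClosedT m n 0 μ ∧
    ∃ ν : Triple N₁ N₂ M₁ M₂, ν.HasDeg 0 ∧ Triple.IsClosedT n m 0 ν ∧
      Triple.HomotopicT m m 0 (ν.compT μ 0) (Triple.idT M₁ M₂) ∧
      Triple.HomotopicT n n 0 (μ.compT ν 0) (Triple.idT N₁ N₂)

namespace Mor

variable {A B C D : Cx k}

theorem diff_apply (n : ℤ) (f : Mor A B) (i j p q : ℤ) (hp : i + n = p) (hq : i + 1 = q) :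
    diff n f i j = (B.d p j).comp (f i p) - (n.negOnePow : ℤ) • (f q j).comp (A.d i q) := by
  subst hp hq
  rfl

theorem comp_apply (g : Mor B C) (f : Mor A B) (n : ℤ) (i j p : ℤ) (hp : i + n = p) :
    comp g f n i j = (g p j).comp (f i p) := by
  subst hp
  rfl

theorem comp_zero_apply (g : Mor B C) (f : Mor A B) (i j : ℤ) :
    comp g f 0 i j = (g i j).comp (f i i) :=
  comp_apply g f 0 i j i (add_zero i)

theorem HasDeg.comp {g : Mor B C} {f : Mor A B} {a b c : ℤ} (hg : g.HasDeg b)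
    (h : a + b = c) : (Mor.comp g f a).HasDeg c := by
  intro i j hij
  rw [comp_apply g f a i j _ rfl, hg _ _ (by omega), LinearMap.zero_comp]

theorem HasDeg.sub {f g : Mor A B} {n : ℤ} (hf : f.HasDeg n) (hg : g.HasDeg n) :
    HasDeg (f - g) n := by
  intro i j hij
  simp [hf i j hij, hg i j hij]

theorem diff_sub (n : ℤ) (f g : Mor A B) : diff n (f - g) = diff n f - diff n g := by
  funext i j
  simp only [diff, Pi.sub_apply, LinearMap.comp_sub, LinearMap.sub_comp, smul_sub]
  abel

theorem comp_d_of_isClosed {f : Mor A B} (hf : IsClosed 0 f) (i j p : ℤ) (hp : i + 1 = p) :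
    (B.d i j).comp (f i i) = (f p j).comp (A.d i p) := by
  have h := congrFun (congrFun hf i) j
  rw [diff_apply 0 f i j i p (add_zero i) hp] at h
  simpa [sub_eq_zero] using h

/-- Leibniz rule for postcomposition with a closed morphism of degree `0`. -/
theorem diff_comp_of_isClosed_left {g : Mor B C} (hg : IsClosed 0 g) (f : Mor A B)
    {n l : ℤ} (hl : n + 1 = l) : diff n (comp g f n) = comp g (diff n f) l := by
  funext i j
  rw [diff_apply n _ i j (i + n) (i + 1) rfl rfl, comp_apply _ _ _ _ _ (i + n) rfl,
    comp_apply _ _ _ _ _ (i + l) (by omega), comp_apply _ _ _ _ _ (i + l) rfl,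
    diff_apply n f i (i + l) (i + n) (i + 1) rfl rfl, LinearMap.comp_sub,
    ← LinearMap.comp_assoc, comp_d_of_isClosed hg _ _ (i + l) (by omega)]
  ext x
  simp

/-- Leibniz rule for precomposition with a closed morphism of degree `0`. -/
theorem diff_comp_of_isClosed_right (g : Mor B C) {f : Mor A B} (hf : IsClosed 0 f)
    (n : ℤ) : diff n (comp g f 0) = comp (diff n g) f 0 := by
  funext i j
  rw [diff_apply n _ i j (i + n) (i + 1) rfl rfl, comp_zero_apply, comp_zero_apply,
    comp_zero_apply, diff_apply n g i j (i + n) (i + 1) rfl rfl, LinearMap.sub_comp,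
    LinearMap.smul_comp]
  simp only [LinearMap.comp_assoc]
  rw [comp_d_of_isClosed hf i (i + 1) (i + 1) rfl]

theorem idM_apply_self (A : Cx k) (i : ℤ) : idM A i i = LinearMap.id := by
  simp [idM, Cx.cast]

theorem idM_comp {f : Mor A B} (hf : f.HasDeg 0) : comp (idM B) f 0 = f := by
  funext i j
  rw [comp_zero_apply]
  by_cases h : i = j
  · subst h
    rw [idM_apply_self, LinearMap.id_comp]
  · rw [hf i j (by omega)]
    simp [idM, h]

theorem comp_idM (f : Mor A B) : comp f (idM A) 0 = f := by
  funext i j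
  rw [comp_zero_apply, idM_apply_self, LinearMap.comp_id]

theorem comp_assoc (h : Mor C D) (g : Mor B C) (f : Mor A B) :
    comp (comp h g 0) f 0 = comp h (comp g f 0) 0 := by
  funext i j
  simp only [comp_zero_apply, LinearMap.comp_assoc]

theorem comp_sub (g : Mor B C) (f f' : Mor A B) (n : ℤ) :
    comp g (f - f') n = comp g f n - comp g f' n := by
  funext i j
  exact LinearMap.comp_sub _ _ _

theorem sub_comp (g g' : Mor B C) (f : Mor A B) (n : ℤ) :
    comp (g - g') f n = comp g f n - comp g' f n := by
  funext i j
  exact LinearMap.sub_comp _ _ _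

end Mor

/-- Given a closed degree-`0` triple morphism `μ` whose components `μ¹`, `μ²` have
chosen homotopy inverses `ν¹`, `ν²`, there is a `ν⁰` making `(ν¹, ν⁰, ν²)` a closed
degree-`0` triple morphism in the opposite direction; equivalently
`dν⁰ = ν² ∘ n - m ∘ ν¹`. -/
theorem statement_2 {M₁ M₂ N₁ N₂ : Cx k}
    (hM₁ : M₁.IsComplex) (hM₂ : M₂.IsComplex) (hN₁ : N₁.IsComplex) (hN₂ : N₂.IsComplex)
    (m : Mor M₁ M₂) (n : Mor N₁ N₂) (hm : IsChainMap m) (hn : IsChainMap n)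
    (μ : Triple M₁ M₂ N₁ N₂) (hμd : μ.HasDeg 0) (hμc : Triple.IsClosedT m n 0 μ)
    (ν₁ : Mor N₁ M₁) (ν₂ : Mor N₂ M₂)
    (h₁ : AreHtpyInverse μ.one ν₁) (h₂ : AreHtpyInverse μ.two ν₂) :
    ∃ ν₀ : Mor N₁ M₂, Mor.HasDeg ν₀ (-1) ∧
      Triple.IsClosedT n m 0 ⟨ν₁, ν₀, ν₂⟩ ∧
      Mor.diff (-1) ν₀ = Mor.comp ν₂ n 0 - Mor.comp m ν₁ 0 := by
  obtain ⟨-, hμ₀, -⟩ := hμc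
  obtain ⟨-, ⟨-, hν₁c⟩, -, t, htd, ht⟩ := h₁
  obtain ⟨-, ⟨hν₂d, hν₂c⟩, ⟨s, hsd, hs⟩, -⟩ := h₂
  have hμ₀' : Mor.diff (-1) μ.zero = Mor.comp μ.two m 0 - Mor.comp n μ.one 0 := by
    have h : Mor.diff (-1) μ.zero +
        ((0 : ℤ).negOnePow : ℤ) • (Mor.comp n μ.one 0 - Mor.comp μ.two m 0) = 0 := hμ₀
    rw [Int.negOnePow_zero, Units.val_one, one_smul] at h
    rw [eq_neg_of_add_eq_zero_left h, neg_sub]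
  rw [zero_sub] at htd ht hsd hs
  have key : Mor.diff (-1) (Mor.comp (Mor.comp s m 0) ν₁ 0 - Mor.comp ν₂ (Mor.comp n t (-1)) (-1) -
      Mor.comp ν₂ (Mor.comp μ.zero ν₁ 0) (-1)) = Mor.comp ν₂ n 0 - Mor.comp m ν₁ 0 := by
    rw [Mor.diff_sub, Mor.diff_sub, Mor.diff_comp_of_isClosed_right _ hν₁c,
      Mor.diff_comp_of_isClosed_right _ hm.2, hs,
      Mor.diff_comp_of_isClosed_left hν₂c _ (l := 0) (by norm_num),
      Mor.diff_comp_of_isClosed_left hn.2 _ (l := 0) (by norm_num), ht,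
      Mor.diff_comp_of_isClosed_left hν₂c _ (l := 0) (by norm_num),
      Mor.diff_comp_of_isClosed_right _ hν₁c, hμ₀']
    simp only [Mor.sub_comp, Mor.comp_sub, Mor.idM_comp hm.1, Mor.comp_idM, Mor.comp_assoc]
    abel
  refine ⟨_, ?_, ⟨hν₁c, ?_, hν₂c⟩, key⟩
  · have h_left : (Mor.comp s m 0).HasDeg (-1) := hsd.comp (by norm_num)
    exact ((h_left.comp (by norm_num)).sub (hν₂d.comp (by norm_num))).sub
      (hν₂d.comp (by norm_num))
  · change Mor.diff (-1) _ +
      ((0 : ℤ).negOnePow : ℤ) • (Mor.comp m ν₁ 0 - Mor.comp ν₂ n 0) = 0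
    rw [key, Int.negOnePow_zero, Units.val_one, one_smul]
    abel

end ThesisDG
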